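/- Let X ⊆ FIN_{A⋆} be an infinite block sequence and let f : [X]_A → C be a coloring into a finite set C. Then one of the following holds: (1) there is an infinite block sequence Y ⊆ [X]_{A⋆} which is f-thin for some color i ∈ C; or (2) there are a finite set F ⊆ [X]_{A⋆} and an infinite block sequence Y ⊆ [X − F]_{A⋆} such that F full-matches Y. -/

import Mathlib

namespace Carlson

/-- The domain of a partial function `ℕ →. B`, encoded as `ℕ → Option B`. -/
def dom {B : Type*} (p : ℕ → Option B) : Set ℕ := {n | p n ≠ none}

/-- `p` is a located word over `B`: a partial function with finite nonempty domain. -/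
def IsLW {B : Type*} (p : ℕ → Option B) : Prop := (dom p).Finite ∧ (dom p).Nonempty

/-- A located variable word over `A` is a located word over `Option A`
(where `none` encodes the variable `⋆`) taking the value `⋆` at least once. -/
def IsLVW {A : Type*} (p : ℕ → Option (Option A)) : Prop :=
  IsLW p ∧ ∃ n, p n = some none

/-- `p < q`: every element of the domain of `p` is below every element of the domain of `q`. -/
def blt {B : Type*} (p q : ℕ → Option B) : Prop :=
  ∀ m ∈ dom p, ∀ n ∈ dom q, m < n

/-- Union `p ∪ q` of two partial functions (`p` takes precedence; for `blt p q`
the domains are disjoint, so this is the genuine union). -/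
def pun {B : Type*} (p q : ℕ → Option B) : ℕ → Option B :=
  fun n => (p n).elim (q n) some

/-- The empty partial function. -/
def emptyW {B : Type*} : ℕ → Option B := fun _ => none

/-- `p[a]`: substitution of the letter `a ∈ A` for the variable `⋆` in a located
variable word. -/
def substA {A : Type*} (p : ℕ → Option (Option A)) (a : A) : ℕ → Option A :=
  fun n => (p n).map fun x => x.getD a

/-- `p[a]` for `a ∈ A ∪ {⋆}` (with `none` encoding `⋆`, so `p[⋆] = p`). -/
def substV {A : Type*} (p : ℕ → Option (Option A)) (a : Option A) : ℕ → Option (Option A) :=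
  fun n => (p n).map fun x => x.elim a some

/-- Union of a finite family of partial functions with pairwise disjoint domains. -/
def famUnion {B : Type*} {k : ℕ} (g : Fin k → ℕ → Option B) : ℕ → Option B :=
  fun n => ((List.ofFn fun i => g i n).filterMap id).head?

/-- A block sequence: a set of located variable words totally ordered by `<`. -/
def IsBlockSeq {A : Type*} (X : Set (ℕ → Option (Option A))) : Prop :=
  (∀ p ∈ X, IsLVW p) ∧ ∀ p ∈ X, ∀ q ∈ X, p = q ∨ blt p q ∨ blt q p

/-- `[X]_A`: located words of the form `p₀[a₀] ∪ ⋯ ∪ p_k[a_k]` with `p₀ < ⋯ < p_k`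
all in `X` and `a₀, …, a_k ∈ A`. -/
def combA {A : Type*} (X : Set (ℕ → Option (Option A))) : Set (ℕ → Option A) :=
  { q | ∃ (k : ℕ) (p : Fin (k + 1) → ℕ → Option (Option A)) (a : Fin (k + 1) → A),
      (∀ i, p i ∈ X) ∧ (∀ i j : Fin (k + 1), i < j → blt (p i) (p j)) ∧
      q = famUnion fun i => substA (p i) (a i) }

/-- `[X]_{A⋆}`: located variable words of the form `p₀[a₀] ∪ ⋯ ∪ p_k[a_k]` with
`p₀ < ⋯ < p_k` all in `X`, `a₀, …, a_k ∈ A ∪ {⋆}`, and `⋆` used at least once. -/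
def combV {A : Type*} (X : Set (ℕ → Option (Option A))) : Set (ℕ → Option (Option A)) :=
  { q | ∃ (k : ℕ) (p : Fin (k + 1) → ℕ → Option (Option A)) (a : Fin (k + 1) → Option A),
      (∀ i, p i ∈ X) ∧ (∀ i j : Fin (k + 1), i < j → blt (p i) (p j)) ∧
      (∃ i, a i = none) ∧ q = famUnion fun i => substV (p i) (a i) }

/-- `X − F`: the elements of `X` whose domain lies entirely above the domains of
all members of `F`. -/
def sminus {B : Type*} (X F : Set (ℕ → Option B)) : Set (ℕ → Option B) :=
  { q ∈ X | ∀ p ∈ F, blt p q }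

/-- `dom q ⊆ [0, ℓ)`. -/
def domBelow {B : Type*} (q : ℕ → Option B) (ℓ : ℕ) : Prop := ∀ n ∈ dom q, n < ℓ

/-- `dom q ⊆ [m, ∞)`. -/
def domAbove {B : Type*} (q : ℕ → Option B) (m : ℕ) : Prop := ∀ n ∈ dom q, m ≤ n

/-- `S^ℓ_p(f) = S^ℓ_{p'}(g)` for colorings of located words: agreement at `q ∪ p`
vs `q ∪ p'` for every located word `q` with domain contained in `[0, ℓ)`.
(Take `p' = emptyW` to express `S^ℓ_p(f) = S^ℓ(g)`.) -/
def SEq {A C : Type*} (f g : (ℕ → Option A) → C) (ℓ : ℕ) (p p' : ℕ → Option A) : Prop :=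
  ∀ q : ℕ → Option A, IsLW q → domBelow q ℓ → f (pun q p) = g (pun q p')

/-- Variant of `SEq` for colorings that are also defined at the empty located word,
i.e. `q` ranges over `FIN_A(0, ℓ) ∪ {∅}`. -/
def SEq0 {A C : Type*} (f g : (ℕ → Option A) → C) (ℓ : ℕ) (p p' : ℕ → Option A) : Prop :=
  ∀ q : ℕ → Option A, (dom q).Finite → domBelow q ℓ → f (pun q p) = g (pun q p')

/-- A coloring `f` is recurrent if for every `ℓ` there is a located variable word `p`
with domain in `[ℓ, ∞)` such that `S^ℓ_{p[a]}(f) = S^ℓ(f)` for every `a ∈ A`. -/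
def Recurrent {A C : Type*} (f : (ℕ → Option A) → C) : Prop :=
  ∀ ℓ : ℕ, ∃ p : ℕ → Option (Option A), IsLVW p ∧ domAbove p ℓ ∧
    ∀ a : A, SEq f f ℓ (substA p a) emptyW

/-- A coloring `f` is uniformly recurrent if for every `ℓ` there is `m > ℓ` such that
for every `p ∈ FIN_A(m, ∞)` there is `q ∈ FIN_A(ℓ, m)` with `S^ℓ_{q ∪ p}(f) = S^ℓ(f)`. -/
def UnifRecurrent {A C : Type*} (f : (ℕ → Option A) → C) : Prop :=
  ∀ ℓ : ℕ, ∃ m : ℕ, ℓ < m ∧ ∀ p : ℕ → Option A, IsLW p → domAbove p m →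
    ∃ q : ℕ → Option A, IsLW q ∧ domAbove q ℓ ∧ domBelow q m ∧
      SEq f f ℓ (pun q p) emptyW

/-- `f` and `g` are weakly proximal: for every `ℓ` there is `p ∈ FIN_A(ℓ, ∞)` with
`S^ℓ_p(f) = S^ℓ_p(g)`. -/
def WeakProx {A C : Type*} (f g : (ℕ → Option A) → C) : Prop :=
  ∀ ℓ : ℕ, ∃ p : ℕ → Option A, IsLW p ∧ domAbove p ℓ ∧ SEq f g ℓ p p

/-- `g` is strongly proximal to `f`: for every `ℓ` there is a located variable word `p`
with domain in `[ℓ, ∞)` such that `S^ℓ(g) = S^ℓ_{p[a]}(g) = S^ℓ_{p[a]}(f)` for all `a ∈ A`. -/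
def StrongProx {A C : Type*} (g f : (ℕ → Option A) → C) : Prop :=
  ∀ ℓ : ℕ, ∃ p : ℕ → Option (Option A), IsLVW p ∧ domAbove p ℓ ∧
    ∀ a : A, SEq g g ℓ emptyW (substA p a) ∧ SEq g f ℓ (substA p a) (substA p a)

/-- `Recurrent` for colorings also defined at the empty located word. -/
def Recurrent0 {A C : Type*} (f : (ℕ → Option A) → C) : Prop :=
  ∀ ℓ : ℕ, ∃ p : ℕ → Option (Option A), IsLVW p ∧ domAbove p ℓ ∧
    ∀ a : A, SEq0 f f ℓ (substA p a) emptyW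

/-- `StrongProx` for colorings also defined at the empty located word. -/
def StrongProx0 {A C : Type*} (g f : (ℕ → Option A) → C) : Prop :=
  ∀ ℓ : ℕ, ∃ p : ℕ → Option (Option A), IsLVW p ∧ domAbove p ℓ ∧
    ∀ a : A, SEq0 g g ℓ emptyW (substA p a) ∧ SEq0 g f ℓ (substA p a) (substA p a)

/-- Agreement of two colorings on all located words with domain in `[0, ℓ)`. -/
def AgreeBelow {A C : Type*} (f g : (ℕ → Option A) → C) (ℓ : ℕ) : Prop :=
  ∀ q : ℕ → Option A, IsLW q → domBelow q ℓ → f q = g q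

/-- Closedness of a class in `C^{FIN_A}` with the product topology (`C` discrete):
a class is closed iff it contains every coloring all of whose finite restrictions
(to located words with domain in `[0, ℓ)`, for each `ℓ`) are matched within the class. -/
def IsClosedColl {A C : Type*} (𝓒 : Set ((ℕ → Option A) → C)) : Prop :=
  ∀ f, (∀ ℓ : ℕ, ∃ g ∈ 𝓒, AgreeBelow f g ℓ) → f ∈ 𝓒

/-- A subshift: a nonempty closed class `𝓒 ⊆ C^{FIN_A}` such that for every `f ∈ 𝓒`,
`ℓ ∈ ℕ` and `p ∈ FIN_A(ℓ, ∞)` there is `g ∈ 𝓒` with `S^ℓ(g) = S^ℓ_p(f)`. -/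
def IsSubshift {A C : Type*} (𝓒 : Set ((ℕ → Option A) → C)) : Prop :=
  𝓒.Nonempty ∧ IsClosedColl 𝓒 ∧
    ∀ f ∈ 𝓒, ∀ ℓ : ℕ, ∀ p : ℕ → Option A, IsLW p → domAbove p ℓ →
      ∃ g ∈ 𝓒, SEq g f ℓ emptyW p

/-- A minimal subshift: no subshift is a proper subset of it. -/
def IsMinimalSubshift {A C : Type*} (𝓒 : Set ((ℕ → Option A) → C)) : Prop :=
  IsSubshift 𝓒 ∧ ∀ 𝓓 : Set ((ℕ → Option A) → C), IsSubshift 𝓓 → 𝓓 ⊆ 𝓒 → 𝓓 = 𝓒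

/-- The orbit closure of a coloring `f`: all `g` such that for every `ℓ` and every
`q ∈ FIN_A(ℓ, ∞)` there is `p ∈ FIN_A(ℓ, ∞)` with `S^ℓ_q(g) = S^ℓ_p(f)`. -/
def orbCl {A C : Type*} (f : (ℕ → Option A) → C) : Set ((ℕ → Option A) → C) :=
  { g | ∀ ℓ : ℕ, ∀ q : ℕ → Option A, IsLW q → domAbove q ℓ →
      ∃ p : ℕ → Option A, IsLW p ∧ domAbove p ℓ ∧ SEq g f ℓ q p }

/-- A variable word over `A`, encoded as a list over `Option A` with `none` = `⋆`:
the variable must occur at least once. -/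
def IsVarWord {A : Type*} (w : List (Option A)) : Prop := none ∈ w

/-- `w[a]`: replace every occurrence of the variable `⋆` by the letter `a`. -/
def substW {A : Type*} (w : List (Option A)) (a : A) : List A :=
  w.map fun x => x.getD a

/-- `⟨(w_n)_{n∈ℕ}⟩_A`: the words `w_{j₀}[a₀] ⋯ w_{j_{k-1}}[a_{k-1}]` extracted from
the sequence `(w_n)`, for `j₀ < ⋯ < j_{k-1}` and letters `a₀, …, a_{k-1} ∈ A`. -/
def extracted {A : Type*} (w : ℕ → List (Option A)) : Set (List A) :=
  { u | ∃ (k : ℕ) (j : Fin (k + 1) → ℕ) (a : Fin (k + 1) → A),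
      StrictMono j ∧ u = (List.ofFn fun i => substW (w (j i)) (a i)).flatten }

section IdempotentPairs

/-- A nonempty closed subsemigroup of a compact right-topological semigroup contains a minimal
closed left ideal. -/
theorem exists_minimal_closed_left_ideal {N : Type*} [Semigroup N] [TopologicalSpace N]
    [CompactSpace N] {S : Set N} (hS : IsClosed S) (hne : S.Nonempty)
    (hmul : ∀ x ∈ S, ∀ y ∈ S, x * y ∈ S) :
    ∃ L ⊆ S, IsClosed L ∧ L.Nonempty ∧ (∀ x ∈ S, ∀ y ∈ L, x * y ∈ L) ∧
      ∀ L' ⊆ L, IsClosed L' → L'.Nonempty → (∀ x ∈ S, ∀ y ∈ L', x * y ∈ L') → L' = L := by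
  let I : Set (Set N) :=
    {L | L ⊆ S ∧ IsClosed L ∧ L.Nonempty ∧ ∀ x ∈ S, ∀ y ∈ L, x * y ∈ L}
  obtain ⟨L, hLS, hL⟩ := zorn_superset_nonempty I (fun c hc hchain hcne => by
    refine ⟨⋂₀ c, ⟨?_, ?_, ?_, ?_⟩, fun s hs => Set.sInter_subset_of_mem hs⟩
    · obtain ⟨s, hs⟩ := hcne
      exact (Set.sInter_subset_of_mem hs).trans (hc hs).1
    · exact isClosed_sInter fun s hs => (hc hs).2.1
    · have := hcne.to_subtype
      rw [Set.sInter_eq_iInter]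
      refine IsCompact.nonempty_iInter_of_directed_nonempty_isCompact_isClosed _ ?_
        (fun s => (hc s.2).2.2.1) (fun s => (hc s.2).2.1.isCompact) (fun s => (hc s.2).2.1)
      rintro ⟨s, hs⟩ ⟨t, ht⟩
      rcases hchain.total hs ht with h | h
      · exact ⟨⟨s, hs⟩, subset_rfl, h⟩
      · exact ⟨⟨t, ht⟩, h, subset_rfl⟩
    · exact fun x hx y hy s hs => (hc hs).2.2.2 x hx y (hy s hs)) S ⟨subset_rfl, hS, hne, hmul⟩
  refine ⟨L, hLS, hL.prop.2.1, hL.prop.2.2.1, hL.prop.2.2.2, fun L' h hcl hne' hid => ?_⟩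
  exact hL.eq_of_subset ⟨h.trans hLS, hcl, hne', hid⟩ h

/-- If `S` and `V` are closed subsemigroups of a compact right-topological semigroup and `V` is
absorbed by `S` on both sides, then some minimal idempotent `v` of `S` has an idempotent of `V`
below it. -/
theorem exists_idempotent_le_minimal_idempotent {N : Type*} [Semigroup N] [TopologicalSpace N]
    [CompactSpace N] [T2Space N] (hcont : ∀ r : N, Continuous (· * r)) {S V : Set N}
    (hS : IsClosed S) (hSne : S.Nonempty) (hSS : ∀ x ∈ S, ∀ y ∈ S, x * y ∈ S)
    (hV : IsClosed V) (hVne : V.Nonempty) (hVV : ∀ x ∈ V, ∀ y ∈ V, x * y ∈ V)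
    (hSV : ∀ x ∈ S, ∀ y ∈ V, x * y ∈ V) (hVS : ∀ x ∈ V, ∀ y ∈ S, x * y ∈ V) :
    ∃ v ∈ S, ∃ w ∈ V, v * v = v ∧ w * w = w ∧ w * v = w ∧ v * w = w ∧
      ∀ u ∈ S, u * u = u → u * v = u → v * u = u → u = v := by
  obtain ⟨L, hLS, hLc, hLne, hLid, hLmin⟩ := exists_minimal_closed_left_ideal hS hSne hSS
  obtain ⟨v, hvL, hvv⟩ := exists_idempotent_in_compact_subsemigroup hcont L hLne hLc.isCompact
    fun x hx y hy => hLid x (hLS hx) y hy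
  have hvS := hLS hvL
  obtain ⟨e, ⟨x, hx, hxe⟩, hee⟩ := exists_idempotent_in_compact_subsemigroup hcont ((· * v) '' V)
    (hVne.image _) (hV.isCompact.image (hcont v)) (by
      rintro _ ⟨x, hx, rfl⟩ _ ⟨y, hy, rfl⟩
      exact ⟨x * v * y, hVV _ (hVS _ hx _ hvS) _ hy, by simp only [mul_assoc]⟩)
  have hev : e * v = e := by
    rw [← hxe]
    change x * v * v = x * v
    rw [mul_assoc, hvv]
  have heV : e ∈ V := hxe ▸ hVS x hx v hvS
  refine ⟨v, hvS, v * e, hSV v hvS e heV, hvv, ?_, ?_, ?_, fun u hu huu huv hvu => ?_⟩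
  · rw [mul_assoc, ← mul_assoc e v e, hev, hee]
  · rw [mul_assoc, hev]
  · rw [← mul_assoc, hvv]
  · have huL : u ∈ L := huv ▸ hLid u hu v hvL
    have hSu : (· * u) '' S = L := by
      refine hLmin _ ?_ (hS.isCompact.image (hcont u)).isClosed (hSne.image _) ?_
      · rintro _ ⟨s, hs, rfl⟩
        exact hLid s hs u huL
      · rintro x hx _ ⟨s, hs, rfl⟩
        exact ⟨x * s, hSS x hx s hs, mul_assoc _ _ _⟩
    obtain ⟨s, -, hsv⟩ := hSu.symm ▸ hvL
    have : v * u = v := by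
      rw [← hsv]
      change s * u * u = s * u
      rw [mul_assoc, huu]
    exact hvu.symm.trans this

end IdempotentPairs

section Words

variable {A B : Type*}

theorem pun_assoc (p q r : ℕ → Option B) : pun (pun p q) r = pun p (pun q r) := by
  funext n
  simp only [pun]
  cases p n <;> rfl

@[simp] theorem mem_dom {p : ℕ → Option B} {n : ℕ} : n ∈ dom p ↔ p n ≠ none := Iff.rfl

theorem dom_pun (p q : ℕ → Option B) : dom (pun p q) = dom p ∪ dom q := by
  ext n
  simp only [mem_dom, pun, Set.mem_union]
  cases p n <;> simp

@[simp] theorem dom_substV (p : ℕ → Option (Option A)) (a : Option A) :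
    dom (substV p a) = dom p := by
  ext n
  simp [substV]

theorem substV_pun (p q : ℕ → Option (Option A)) (a : Option A) :
    substV (pun p q) a = pun (substV p a) (substV q a) := by
  funext n
  simp only [pun, substV]
  cases p n <;> rfl

theorem substA_pun (p q : ℕ → Option (Option A)) (a : A) :
    substA (pun p q) a = pun (substA p a) (substA q a) := by
  funext n
  simp only [pun, substA]
  cases p n <;> rfl

theorem substV_substV (p : ℕ → Option (Option A)) (b : Option A) (a : Option A) :
    substV (substV p b) a = substV p (b.elim a some) := by
  funext n
  simp only [substV, Option.map_map]
  congr 1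
  funext x
  cases x <;> rfl

theorem substA_substV (p : ℕ → Option (Option A)) (a b : A) :
    substA (substV p (some a)) b = substA p a := by
  funext n
  simp only [substV, substA, Option.map_map]
  congr 1
  funext x
  cases x <;> rfl

theorem substV_none (p : ℕ → Option (Option A)) : substV p none = p := by
  funext n
  rcases h : p n with _ | _ | _ <;> simp [substV, h]

theorem famUnion_one (g : Fin 1 → ℕ → Option B) : famUnion g = g 0 := by
  funext n
  simp only [famUnion, List.ofFn_succ, List.ofFn_zero]
  cases g 0 n <;> rfl

theorem famUnion_succ {k : ℕ} (g : Fin (k + 1) → ℕ → Option B) :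
    famUnion g = pun (g 0) (famUnion fun i => g i.succ) := by
  funext n
  simp only [famUnion, pun, List.ofFn_succ]
  cases g 0 n <;> rfl

theorem substA_famUnion (a : A) {k : ℕ} (g : Fin (k + 1) → ℕ → Option (Option A)) :
    substA (famUnion g) a = famUnion fun i => substA (g i) a := by
  induction k with
  | zero => rw [famUnion_one, famUnion_one]
  | succ k ih => rw [famUnion_succ, substA_pun, ih, famUnion_succ fun i => substA (g i) a]

/-- The variable `⋆` occurs in `p`. -/
def HasStar {A : Type*} (p : ℕ → Option (Option A)) : Prop := ∃ n, p n = some none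

theorem HasStar.pun_left {p : ℕ → Option (Option A)} (h : HasStar p)
    (q : ℕ → Option (Option A)) : HasStar (pun p q) := by
  obtain ⟨n, hn⟩ := h
  exact ⟨n, by simp [pun, hn]⟩

theorem HasStar.pun_right {p q : ℕ → Option (Option A)} (h : HasStar q) (hpq : blt p q) :
    HasStar (pun p q) := by
  obtain ⟨n, hn⟩ := h
  refine ⟨n, ?_⟩
  have : p n = none := by
    by_contra hp
    exact lt_irrefl n (hpq n hp n (by simp [hn]))
  simp [pun, hn, this]

theorem HasStar.of_pun {p q : ℕ → Option (Option A)} (h : HasStar (pun p q)) :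
    HasStar p ∨ HasStar q := by
  obtain ⟨n, hn⟩ := h
  simp only [pun] at hn
  rcases hp : p n with _ | x
  · exact .inr ⟨n, by simpa [hp] using hn⟩
  · exact .inl ⟨n, by simpa [hp] using hn⟩

theorem not_hasStar_substV (p : ℕ → Option (Option A)) (a : A) :
    ¬ HasStar (substV p (some a)) := by
  rintro ⟨n, hn⟩
  rcases h : p n with _ | _ | _ <;> simp [substV, h] at hn

theorem substV_of_not_hasStar {p : ℕ → Option (Option A)} (hp : ¬ HasStar p) (a : Option A) :
    substV p a = p := by
  funext n
  rcases h : p n with _ | _ | _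
  · simp [substV, h]
  · exact absurd ⟨n, h⟩ hp
  · simp [substV, h]

/-- The words `p₀[a₀] ∪ ⋯ ∪ p_k[a_k]` with `p₀ < ⋯ < p_k` in `X` and `a₀, …, a_k ∈ A ∪ {⋆}`, where
the variable need not occur. -/
inductive Comb (X : Set (ℕ → Option (Option A))) : (ℕ → Option (Option A)) → Prop
  | single {p} (hp : p ∈ X) (a : Option A) : Comb X (substV p a)
  | cons {p q} (hp : p ∈ X) (a : Option A) (hq : Comb X q) (hpq : blt p q) :
      Comb X (pun (substV p a) q)

namespace Comb

variable {X : Set (ℕ → Option (Option A))} {p q : ℕ → Option (Option A)}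

theorem isLW (hX : ∀ p ∈ X, IsLW p) (hp : Comb X p) : IsLW p := by
  induction hp with
  | single hp a => simpa [IsLW] using hX _ hp
  | cons hp a hq hpq ih =>
    simp only [IsLW, dom_pun, dom_substV]
    exact ⟨(hX _ hp).1.union ih.1, (hX _ hp).2.inl⟩

theorem pun (hp : Comb X p) (hq : Comb X q) (hpq : blt p q) : Comb X (pun p q) := by
  induction hp with
  | single hp a => exact cons hp a hq (by simpa [blt] using hpq)
  | @cons p p' hp a hp' hpp' ih =>
    rw [pun_assoc]
    simp only [blt, dom_pun, dom_substV] at hpq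
    refine cons hp a (ih fun m hm n hn => hpq m (.inr hm) n hn) fun m hm n hn => ?_
    rw [dom_pun] at hn
    rcases hn with hn | hn
    · exact hpp' m hm n hn
    · exact hpq m (.inl hm) n hn

theorem substV (hp : Comb X p) (a : Option A) : Comb X (substV p a) := by
  induction hp with
  | single hp b => exact substV_substV _ b a ▸ single hp _
  | cons hp b hq hpq ih =>
    rw [substV_pun, substV_substV]
    exact cons hp _ ih (by simpa [blt] using hpq)

theorem sminus {y : ℕ → Option (Option A)} (hp : Comb X p) (hy : blt y p) :
    Comb (sminus X {y}) p := by
  induction hp with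
  | @single p hp a =>
    have hp' : p ∈ Carlson.sminus X {y} := ⟨hp, by simpa [blt] using hy⟩
    exact single hp' a
  | @cons p q hp a hq hpq ih =>
    simp only [blt, dom_pun, dom_substV] at hy
    have hp' : p ∈ Carlson.sminus X {y} := by
      refine ⟨hp, ?_⟩
      rintro _ rfl m hm n hn
      exact hy m hm n (.inl hn)
    exact cons hp' a (ih fun m hm n hn => hy m hm n (.inr hn)) hpq

theorem exists_famUnion (hp : Comb X p) :
    ∃ (k : ℕ) (g : Fin (k + 1) → ℕ → Option (Option A)) (a : Fin (k + 1) → Option A),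
      (∀ i, g i ∈ X) ∧ (∀ i j : Fin (k + 1), i < j → blt (g i) (g j)) ∧
      (∀ i, dom (g i) ⊆ dom p) ∧ (HasStar p → ∃ i, a i = none) ∧
      p = famUnion fun i => Carlson.substV (g i) (a i) := by
  induction hp with
  | @single p hp a =>
    refine ⟨0, fun _ => p, fun _ => a, fun _ => hp, fun i j hij => by omega, by simp,
      fun h => ⟨0, ?_⟩, by rw [famUnion_one]⟩
    cases a with
    | none => rfl
    | some a => exact absurd h (not_hasStar_substV p a)
  | @cons p q hp a hq hpq ih =>
    obtain ⟨k, g, b, hg, hlt, hdom, hstar, heq⟩ := ih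
    refine ⟨k + 1, Fin.cons p g, Fin.cons a b, ?_, ?_, ?_, ?_, ?_⟩
    · exact Fin.cases hp hg
    · refine Fin.cases (Fin.cases (by simp) fun j _ => ?_)
        fun i => Fin.cases (by simp) fun j h => ?_
      · exact fun m hm n hn => hpq m hm n (hdom j hn)
      · exact hlt i j (by simpa using h)
    · rw [dom_pun, dom_substV]
      exact Fin.cases Set.subset_union_left fun i => (hdom i).trans Set.subset_union_right
    · intro h
      rcases h.of_pun with h | h
      · refine ⟨0, ?_⟩
        cases a with
        | none => rfl
        | some a => exact absurd h (not_hasStar_substV p a)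
      · obtain ⟨i, hi⟩ := hstar h
        exact ⟨i.succ, hi⟩
    · rw [famUnion_succ]
      simp only [Fin.cons_zero, Fin.cons_succ, ← heq]

theorem mem_combV (hp : Comb X p) (h : HasStar p) : p ∈ combV X := by
  obtain ⟨k, g, a, hg, hlt, -, hstar, heq⟩ := hp.exists_famUnion
  exact ⟨k, g, a, hg, hlt, hstar h, heq⟩

end Comb

theorem IsBlockSeq.exists_domAbove {X : Set (ℕ → Option (Option A))} (hX : IsBlockSeq X)
    (hXinf : X.Infinite) (n : ℕ) : ∃ p ∈ X, domAbove p n := by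
  by_contra! h
  have h' : ∀ p : X, ∃ m : Fin n, (m : ℕ) ∈ dom p.1 := fun p => by
    have := h p p.2
    simp only [domAbove, not_forall, not_le] at this
    obtain ⟨m, hm, hmn⟩ := this
    exact ⟨⟨m, hmn⟩, hm⟩
  choose m hm using h'
  have := hXinf.to_subtype
  refine not_injective_infinite_finite m fun p q hpq => Subtype.ext ?_
  have hq := hm q
  rw [← hpq] at hq
  rcases hX.2 p p.2 q q.2 with h | h | h
  · exact h
  · exact absurd (h _ (hm p) _ hq) (lt_irrefl _)
  · exact absurd (h _ hq _ (hm p)) (lt_irrefl _)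

theorem IsLW.exists_blt {p : ℕ → Option B} (hp : IsLW p) :
    ∃ n, ∀ q : ℕ → Option B, domAbove q n → blt p q := by
  obtain ⟨m, hm⟩ := hp.1.bddAbove
  exact ⟨m + 1, fun q hq i hi j hj => (Nat.lt_succ_of_le (hm hi)).trans_le (hq j hj)⟩

end Words

section Ultrafilters

open Filter

variable {A C : Type*}

/-- Partial functions under union, the left argument taking precedence. -/
abbrev punSemigroup {B : Type*} : Semigroup (ℕ → Option B) where
  mul := pun
  mul_assoc := pun_assoc

attribute [local instance] punSemigroup Ultrafilter.semigroup

theorem eventually_mul_pun {B : Type*} (U V : Ultrafilter (ℕ → Option B))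
    (P : (ℕ → Option B) → Prop) :
    (∀ᶠ p in (U * V : Ultrafilter (ℕ → Option B)), P p) ↔ ∀ᶠ p in U, ∀ᶠ q in V, P (pun p q) :=
  Iff.rfl

theorem map_substV_mul (U V : Ultrafilter (ℕ → Option (Option A))) (a : Option A) :
    (U * V).map (substV · a) = U.map (substV · a) * V.map (substV · a) := by
  refine Ultrafilter.coe_inj.mp (Filter.ext' fun P => ?_)
  rw [eventually_mul_pun]
  simp only [Ultrafilter.coe_map, eventually_map, eventually_mul_pun, substV_pun]

/-- The ultrafilters concentrating, arbitrarily far out, on words generated by `X`. -/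
def farComb (X : Set (ℕ → Option (Option A))) : Set (Ultrafilter (ℕ → Option (Option A))) :=
  {U | ∀ n, ∀ᶠ p in U, Comb X p ∧ domAbove p n}

variable {X : Set (ℕ → Option (Option A))}

theorem isClosed_farComb : IsClosed (farComb X) := by
  rw [farComb, Set.ofPred_forall]
  exact isClosed_iInter fun n => ultrafilter_isClosed_basic {p | Comb X p ∧ domAbove p n}

theorem eventually_blt_of_mem_farComb {p : ℕ → Option (Option A)} (hp : IsLW p)
    {U : Ultrafilter (ℕ → Option (Option A))} (hU : U ∈ farComb X) : ∀ᶠ q in U, blt p q := by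
  obtain ⟨n, hn⟩ := hp.exists_blt
  filter_upwards [hU n] with q hq using hn q hq.2

theorem mul_mem_farComb (hX : ∀ p ∈ X, IsLW p) {U V : Ultrafilter (ℕ → Option (Option A))}
    (hU : U ∈ farComb X) (hV : V ∈ farComb X) : U * V ∈ farComb X := by
  intro n
  rw [eventually_mul_pun]
  filter_upwards [hU n] with p hp
  filter_upwards [hV n, eventually_blt_of_mem_farComb (hp.1.isLW hX) hV] with q hq hpq
  refine ⟨hp.1.pun hq.1 hpq, fun m hm => ?_⟩
  rw [dom_pun] at hm
  exact hm.elim (hp.2 m) (hq.2 m)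

theorem map_substV_mem_farComb {U : Ultrafilter (ℕ → Option (Option A))} (hU : U ∈ farComb X)
    (a : Option A) : U.map (substV · a) ∈ farComb X := by
  intro n
  rw [Ultrafilter.coe_map, eventually_map]
  filter_upwards [hU n] with p hp
  exact ⟨hp.1.substV a, by simpa [domAbove] using hp.2⟩

theorem exists_mem_farComb_hasStar (hX : IsBlockSeq X) (hXinf : X.Infinite) :
    ∃ U ∈ farComb X, ∀ᶠ p : ℕ → Option (Option A) in U, HasStar p := by
  choose x hxX hx using hX.exists_domAbove hXinf
  refine ⟨(hyperfilter ℕ).map x, fun n => ?_, ?_⟩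
  · rw [Ultrafilter.coe_map, eventually_map]
    have : ∀ᶠ i in atTop, n ≤ i := eventually_ge_atTop n
    rw [← Nat.cofinite_eq_atTop] at this
    filter_upwards [Filter.hyperfilter_le_cofinite this] with i hi
    exact ⟨substV_none (x i) ▸ .single (hxX i) none, fun m hm => hi.trans (hx i m hm)⟩
  · rw [Ultrafilter.coe_map, eventually_map]
    exact Eventually.of_forall fun i => (hX.1 _ (hxX i)).2

/-- There is an idempotent ultrafilter `v` on words, together with an ultrafilter `w` on variable
words generated by `X` such that every substitution of a letter sends `w` to `v`. -/
theorem exists_idempotent_map_substV [Nonempty A] (hX : IsBlockSeq X) (hXinf : X.Infinite) :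
    ∃ v ∈ farComb X, ∃ w ∈ farComb X, v * v = v ∧ (∀ᶠ p : ℕ → Option (Option A) in w, HasStar p) ∧
      ∀ a : A, w.map (substV · (some a)) = v := by
  have hXLW : ∀ p ∈ X, IsLW p := fun p hp => (hX.1 p hp).1
  obtain ⟨U, hU, hUstar⟩ := exists_mem_farComb_hasStar hX hXinf
  have hmap : ∀ (U : Ultrafilter (ℕ → Option (Option A))) (a : A),
      ∀ᶠ p : ℕ → Option (Option A) in U.map (substV · (some a)), ¬ HasStar p := fun U a => by
    rw [Ultrafilter.coe_map, eventually_map]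
    exact Eventually.of_forall fun p => not_hasStar_substV p a
  have hleft : ∀ U V : Ultrafilter (ℕ → Option (Option A)),
      (∀ᶠ p : ℕ → Option (Option A) in U, HasStar p) →
        ∀ᶠ p : ℕ → Option (Option A) in (U * V : Ultrafilter _), HasStar p := fun U V h => by
    rw [eventually_mul_pun]
    filter_upwards [h] with p hp
    exact Eventually.of_forall fun q => hp.pun_left q
  obtain ⟨v, hv, w, hw, hvv, hww, hwv, hvw, hmin⟩ := exists_idempotent_le_minimal_idempotent
    (N := Ultrafilter (ℕ → Option (Option A))) Ultrafilter.continuous_mul_left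
    (S := farComb X ∩ {U | ∀ᶠ p : ℕ → Option (Option A) in U, ¬ HasStar p})
    (V := farComb X ∩ {U | ∀ᶠ p : ℕ → Option (Option A) in U, HasStar p})
    (isClosed_farComb.inter (ultrafilter_isClosed_basic {p | ¬ HasStar p}))
    ⟨_, map_substV_mem_farComb hU _, hmap U (Classical.arbitrary A)⟩
    (fun U hU V hV => ⟨mul_mem_farComb hXLW hU.1 hV.1, by
      change ∀ᶠ p : ℕ → Option (Option A) in (U * V : Ultrafilter _), ¬ HasStar p
      rw [eventually_mul_pun]
      filter_upwards [hU.2] with p hp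
      filter_upwards [hV.2] with q hq h
      exact h.of_pun.elim hp hq⟩)
    (isClosed_farComb.inter (ultrafilter_isClosed_basic {p | HasStar p}))
    ⟨U, hU, hUstar⟩
    (fun U hU V hV => ⟨mul_mem_farComb hXLW hU.1 hV.1, hleft U V hU.2⟩)
    (fun U hU V hV => ⟨mul_mem_farComb hXLW hU.1 hV.1, by
      change ∀ᶠ p : ℕ → Option (Option A) in (U * V : Ultrafilter _), HasStar p
      rw [eventually_mul_pun]
      filter_upwards [hU.1 0] with p hp
      filter_upwards [hV.2, eventually_blt_of_mem_farComb (hp.1.isLW hXLW) hV.1] with q hq hpq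
      exact hq.pun_right hpq⟩)
    (fun U hU V hV => ⟨mul_mem_farComb hXLW hU.1 hV.1, hleft U V hU.2⟩)
  refine ⟨v, hv.1, w, hw.1, hvv, hw.2, fun a => ?_⟩
  have hva : v.map (substV · (some a)) = v := by
    refine Ultrafilter.coe_inj.mp ?_
    rw [Ultrafilter.coe_map]
    refine (map_congr ?_).trans map_id
    filter_upwards [hv.2] with p hp using substV_of_not_hasStar hp _
  refine hmin _ ⟨map_substV_mem_farComb hw.1 _, hmap w a⟩ ?_ ?_ ?_
  · rw [← map_substV_mul, hww]
  · conv_lhs => rw [← hva, ← map_substV_mul, hwv]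
  · conv_lhs => rw [← hva, ← map_substV_mul, hvw]

/-- **Carlson's theorem** for located words, in a form exhibiting the block sequence as a
sequence `y` and the coloring as constant on words generated by it. -/
theorem exists_seq_combA_range_const [Finite A] [Nonempty A] [Finite C] (hX : IsBlockSeq X)
    (hXinf : X.Infinite) (f : (ℕ → Option A) → C) :
    ∃ (c : C) (y : ℕ → ℕ → Option (Option A)), (∀ n, Comb X (y n) ∧ HasStar (y n)) ∧
      (∀ i j, i < j → blt (y i) (y j)) ∧ ∀ q ∈ combA (Set.range y), f q = c := by
  have hXLW : ∀ p ∈ X, IsLW p := fun p hp => (hX.1 p hp).1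
  obtain ⟨v, hv, w, hw, hvv, hwstar, hwv⟩ := exists_idempotent_map_substV hX hXinf
  let a₀ := Classical.arbitrary A
  obtain ⟨c, hc⟩ := Ultrafilter.eq_pure_of_finite (v.map fun p => f (substA p a₀))
  have hcv : {p | f (substA p a₀) = c} ∈ v := by
    have : {c} ∈ v.map fun p => f (substA p a₀) := hc ▸ rfl
    exact this
  have hstep : ∀ P : {P // P ∈ v}, ∃ y, Comb X y ∧ HasStar y ∧
      ∀ a : A, substV y (some a) ∈ P.1 ∧ ∀ᶠ q in v, pun (substV y (some a)) q ∈ P.1 := by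
    rintro ⟨P, hP⟩
    have hP' : ∀ᶠ p in v, ∀ᶠ q in v, pun p q ∈ P := by
      rw [← eventually_mul_pun, hvv]
      exact hP
    have hPw : ∀ᶠ y in w, ∀ a : A,
        substV y (some a) ∈ P ∧ ∀ᶠ q in v, pun (substV y (some a)) q ∈ P := by
      refine eventually_all.2 fun a => ?_
      have h : ∀ᶠ p in v, p ∈ P ∧ ∀ᶠ q in v, pun p q ∈ P := Filter.Eventually.and hP hP'
      rw [← hwv a, Ultrafilter.coe_map, eventually_map] at h
      rwa [← hwv a]
    obtain ⟨y, ⟨hy, -⟩, hstar, h⟩ := ((hw 0).and (hwstar.and hPw)).exists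
    exact ⟨y, hy, hstar, h⟩
  choose y hyX hystar hy using hstep
  let next : {P // P ∈ v} → {P // P ∈ v} := fun P =>
    ⟨{q | q ∈ P.1 ∧ blt (y P) q ∧ ∀ a : A, pun (substV (y P) (some a)) q ∈ P.1},
      Filter.Eventually.and P.2 ((eventually_blt_of_mem_farComb ((hyX P).isLW hXLW) hv).and
        (eventually_all.2 fun a => (hy P a).2))⟩
  let P : ℕ → {P // P ∈ v} := fun n => next^[n] ⟨_, hcv⟩
  have hPsucc : ∀ n, P (n + 1) = next (P n) := fun n => Function.iterate_succ_apply' _ _ _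
  have hanti : Antitone fun n => (P n).1 := antitone_nat_of_succ_le fun n => by
    rw [hPsucc]
    exact fun q hq => hq.1
  have hlt : ∀ i j, i < j → blt (y (P i)) (y (P j)) := fun i j hij => by
    have h := hanti (Nat.succ_le_of_lt hij) (hy (P j) a₀).1
    simp only [Nat.succ_eq_add_one, hPsucc] at h
    simpa [blt] using h.2.1
  have hmem : ∀ (k : ℕ) (j : Fin (k + 1) → ℕ) (a : Fin (k + 1) → A), StrictMono j →
      (famUnion fun i => substV (y (P (j i))) (some (a i))) ∈ (P (j 0)).1 := by
    intro k
    induction k with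
    | zero =>
      intro j a _
      rw [famUnion_one]
      exact (hy _ _).1
    | succ k ih =>
      intro j a hj
      rw [famUnion_succ]
      have h := hanti (Nat.succ_le_of_lt (hj (Fin.succ_pos 0)))
        (ih (fun i => j i.succ) (fun i => a i.succ) (hj.comp (Fin.strictMono_succ)))
      simp only [Nat.succ_eq_add_one, hPsucc] at h
      exact h.2.2 (a 0)
  refine ⟨c, fun n => y (P n), fun n => ⟨hyX _, hystar _⟩, hlt, ?_⟩
  rintro _ ⟨k, p, a, hp, hplt, rfl⟩
  choose j hj using hp
  have hjmono : StrictMono j := fun i i' hii' => by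
    by_contra! hle
    have h1 : blt (y (P (j i))) (y (P (j i'))) := by
      have := hplt i i' hii'
      rwa [← hj, ← hj] at this
    obtain ⟨n, hn⟩ := ((hyX (P (j i))).isLW hXLW).2
    obtain ⟨m, hm⟩ := ((hyX (P (j i'))).isLW hXLW).2
    rcases hle.eq_or_lt with h | h
    · rw [h] at h1
      exact lt_irrefl n (h1 n hn n hn)
    · exact lt_asymm (h1 n hn m hm) (hlt _ _ h m hm n hn)
  have h := hanti (Nat.zero_le _) (hmem k j a hjmono)
  have h' : f (substA (famUnion fun i => substV (y (P (j i))) (some (a i))) a₀) = c := h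
  rw [substA_famUnion] at h'
  simpa only [substA_substV, hj] using h'

end Ultrafilters

theorem substA_mem_combA {A : Type*} {Y : Set (ℕ → Option (Option A))}
    {p : ℕ → Option (Option A)} (hp : p ∈ Y) (a : A) : substA p a ∈ combA Y :=
  ⟨0, fun _ => p, fun _ => a, fun _ => hp, fun i j hij => by omega, by rw [famUnion_one]⟩

theorem combA_mono {A : Type*} {Y Z : Set (ℕ → Option (Option A))} (h : Y ⊆ Z) :
    combA Y ⊆ combA Z := by
  rintro _ ⟨k, p, a, hp, hlt, rfl⟩
  exact ⟨k, p, a, fun i => h (hp i), hlt, rfl⟩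

theorem pun_substA_mem_combA {A : Type*} {Y Z : Set (ℕ → Option (Option A))} (hYZ : Y ⊆ Z)
    {p : ℕ → Option (Option A)} (hp : p ∈ Z) (hpY : ∀ q ∈ Y, blt p q) (a : A)
    {q : ℕ → Option A} (hq : q ∈ combA Y) : pun (substA p a) q ∈ combA Z := by
  obtain ⟨k, g, b, hg, hlt, rfl⟩ := hq
  refine ⟨k + 1, Fin.cons p g, Fin.cons a b, Fin.cases hp fun i => hYZ (hg i), ?_, ?_⟩
  · refine Fin.cases (Fin.cases (by simp) fun j _ => hpY _ (hg j)) fun i =>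
      Fin.cases (by simp) fun j h => ?_
    exact hlt i j (by simpa using h)
  · exact (famUnion_succ fun i => substA ((Fin.cons p g : Fin (k + 2) → _) i)
      ((Fin.cons a b : Fin (k + 2) → A) i)).symm

/-- Either there is an infinite block sequence `Y ⊆ [X]_{A⋆}` which is `f`-thin for
some color `i ∈ C`, or there are a finite `F ⊆ [X]_{A⋆}` and an infinite block sequence
`Y ⊆ [X − F]_{A⋆}` such that `F` full-matches `Y`. -/
theorem thin_or_full_match {A C : Type*} [Fintype A] [Nonempty A] [Fintype C]
    (X : Set (ℕ → Option (Option A))) (hX : IsBlockSeq X) (hXinf : X.Infinite)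
    (f : (ℕ → Option A) → C) :
    (∃ i : C, ∃ Y : Set (ℕ → Option (Option A)), Y ⊆ combV X ∧
        IsBlockSeq Y ∧ Y.Infinite ∧ ∀ p ∈ combA Y, f p ≠ i) ∨
    (∃ F : Set (ℕ → Option (Option A)), F.Finite ∧ F ⊆ combV X ∧
      ∃ Y : Set (ℕ → Option (Option A)), Y ⊆ combV (sminus X F) ∧
        IsBlockSeq Y ∧ Y.Infinite ∧
        ∀ q ∈ combA Y, ∃ p ∈ F, ∀ a : A,
          f (substA p a) = f q ∧ f (pun (substA p a) q) = f q) := by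
  right
  have hXLW : ∀ p ∈ X, IsLW p := fun p hp => (hX.1 p hp).1
  obtain ⟨c, y, hy, hlt, hc⟩ := exists_seq_combA_range_const hX hXinf f
  have hsub : (Set.range fun n => y (n + 1)) ⊆ Set.range y := by
    rintro _ ⟨n, rfl⟩
    exact ⟨n + 1, rfl⟩
  refine ⟨{y 0}, Set.finite_singleton _, ?_, Set.range fun n => y (n + 1), ?_, ⟨?_, ?_⟩, ?_, ?_⟩
  · rintro _ rfl
    exact (hy 0).1.mem_combV (hy 0).2
  · rintro _ ⟨n, rfl⟩
    exact ((hy (n + 1)).1.sminus (hlt 0 (n + 1) n.succ_pos)).mem_combV (hy _).2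
  · rintro _ ⟨n, rfl⟩
    exact ⟨(hy _).1.isLW hXLW, (hy _).2⟩
  · rintro _ ⟨n, rfl⟩ _ ⟨m, rfl⟩
    rcases lt_trichotomy n m with h | rfl | h
    · exact .inr (.inl (hlt _ _ (by omega)))
    · exact .inl rfl
    · exact .inr (.inr (hlt _ _ (by omega)))
  · refine Set.infinite_range_of_injective (Function.Injective.of_lt_imp_ne fun n m hnm heq => ?_)
    obtain ⟨i, hi⟩ := ((hy (n + 1)).1.isLW hXLW).2
    have h := hlt (n + 1) (m + 1) (by omega)
    rw [← heq] at h
    exact lt_irrefl i (h i hi i hi)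
  · intro q hq
    refine ⟨y 0, rfl, fun a => ?_⟩
    rw [hc q (combA_mono hsub hq)]
    have hy0 : y 0 ∈ Set.range y := ⟨0, rfl⟩
    refine ⟨hc _ (substA_mem_combA hy0 a), hc _ (pun_substA_mem_combA hsub hy0 ?_ a hq)⟩
    rintro _ ⟨n, rfl⟩
    exact hlt 0 (n + 1) n.succ_pos

end Carlson
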